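/- arXiv:1411.1391 — 2 statements merged into one kernel-verified Lean document; each statement's English description precedes it below -/
import Mathlib

section
/- For any finite subset F of ℚ(ν) there exists a unique element d(F) ∈ ℤ[ν+ν⁻¹] such that: d(F)·f ∈ ℤ[ν,ν⁻¹] for every f ∈ F; the degree of d(F) as a polynomial in ν+ν⁻¹ is minimal among all elements of ℤ[ν+ν⁻¹] with this property; and the leading coefficient of d(F) (as a polynomial in ν+ν⁻¹) is positive and minimal among such elements of minimal degree. Moreover, if for every f ∈ F each root (in an algebraic closure of ℚ) of the denominator of f in lowest terms, other than 0, is a root of unity, then d(F) = c·(ν+ν⁻¹−2)^{m₁}·(ν+ν⁻¹+2)^{m₂}·∏_{k≥3} (ν^{−φ(k)/2}·Φ_k(ν))^{m_k}, where c is a positive integer, the m_k are non-negative integers almost all equal to zero, Φ_k ∈ ℤ[ν] is the k-th cyclotomic polynomial, and φ(k) = deg Φ_k is Euler's totient function (which is even for k ≥ 3, so each factor ν^{−φ(k)/2}Φ_k(ν) lies in ℤ[ν+ν⁻¹]). -/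
noncomputable section

/-- The image in `ℚ(ν)` of an integer polynomial evaluated at `ν + ν⁻¹`; thus
`ℤ[ν+ν⁻¹] ⊆ ℚ(ν)` is the set of such values, and the representing polynomial records the
degree and the leading coefficient "as a polynomial in `ν + ν⁻¹`" (the representation is
unique since `ν + ν⁻¹` is transcendental over `ℚ`). -/
def evalAtU (p : Polynomial ℤ) : RatFunc ℚ :=
  Polynomial.eval₂ (Int.castRingHom (RatFunc ℚ)) (RatFunc.X + (RatFunc.X)⁻¹) p

/-- `x ∈ ℤ[ν,ν⁻¹]`, i.e. `x` is an integral Laurent polynomial in `ν`. -/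
def IsIntLaurent (x : RatFunc ℚ) : Prop :=
  ∃ (p : Polynomial ℤ) (n : ℕ),
    x * RatFunc.X ^ n = Polynomial.eval₂ (Int.castRingHom (RatFunc ℚ)) RatFunc.X p

/-- `p` represents an element of `ℤ[ν+ν⁻¹]` clearing the denominators of all members of `F`. -/
def Clears (F : Finset (RatFunc ℚ)) (p : Polynomial ℤ) : Prop :=
  ∀ f ∈ F, IsIntLaurent (evalAtU p * f)

/-- `p` represents `d(F)`: it clears denominators, has positive leading coefficient, has
minimal degree (in `ν+ν⁻¹`) among nonzero elements with the clearing property, and minimal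
(positive) leading coefficient among those of minimal degree. -/
def IsDF (F : Finset (RatFunc ℚ)) (p : Polynomial ℤ) : Prop :=
  Clears F p ∧ 0 < p.leadingCoeff ∧
    (∀ p' : Polynomial ℤ, p' ≠ 0 → Clears F p' → p.degree ≤ p'.degree) ∧
    (∀ p' : Polynomial ℤ, Clears F p' → 0 < p'.leadingCoeff → p'.degree = p.degree →
      p.leadingCoeff ≤ p'.leadingCoeff)

open Polynomial in
/-- The embedding `ℤ[ν] → ℚ(ν)`. -/
def intEmb : ℤ[X] →+* RatFunc ℚ := eval₂RingHom (Int.castRingHom _) RatFunc.X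

open Polynomial in
/-- `evalAtU` as a ring homomorphism. -/
def uHom : ℤ[X] →+* RatFunc ℚ :=
  eval₂RingHom (Int.castRingHom _) (RatFunc.X + (RatFunc.X)⁻¹)

section

open Polynomial

local notation "ν" => (RatFunc.X : RatFunc ℚ)

lemma nu_ne_zero : ν ≠ 0 := RatFunc.X_ne_zero

@[simp] lemma intEmb_X : intEmb X = ν := by simp [intEmb]
@[simp] lemma intEmb_C (a : ℤ) : intEmb (C a) = a := by simp [intEmb]
@[simp] lemma uHom_X : uHom X = ν + ν⁻¹ := by simp [uHom]
@[simp] lemma uHom_C (a : ℤ) : uHom (C a) = a := by simp [uHom]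

lemma evalAtU_eq (p : ℤ[X]) : evalAtU p = uHom p := rfl

lemma intEmb_apply (p : ℤ[X]) :
    intEmb p = algebraMap ℚ[X] (RatFunc ℚ) (p.map (Int.castRingHom ℚ)) := by
  have : intEmb = (algebraMap ℚ[X] (RatFunc ℚ)).comp (mapRingHom (Int.castRingHom ℚ)) := by
    ext <;> simp
  rw [this]; rfl

lemma intEmb_injective : Function.Injective intEmb := by
  intro p q h
  rw [intEmb_apply, intEmb_apply] at h
  exact map_injective _ Int.cast_injective (RatFunc.algebraMap_injective ℚ h)

/-- Clearing powers of `ν`, a polynomial of degree `n` in `ν + ν⁻¹` becomes a polynomial of degree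
`2 * n` in `ν` with the same leading coefficient. -/
lemma exists_intEmb_eq (p : ℤ[X]) : ∃ s : ℤ[X], s.natDegree = 2 * p.natDegree ∧
    s.leadingCoeff = p.leadingCoeff ∧ intEmb s = ν ^ p.natDegree * uHom p := by
  set n := p.natDegree with hn
  have hmon : (X ^ 2 + 1 : ℤ[X]).Monic := by monicity!
  have hdeg (i : ℕ) : ((X ^ 2 + 1 : ℤ[X]) ^ i).natDegree = 2 * i := by
    rw [hmon.natDegree_pow, mul_comm]
    congr 1
    compute_degree!
  let s : ℤ[X] := ∑ i ∈ Finset.range (n + 1), C (p.coeff i) * X ^ (n - i) * (X ^ 2 + 1) ^ i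
  have hterm (i : ℕ) : (C (p.coeff i) * X ^ (n - i) * (X ^ 2 + 1) ^ i).natDegree
      ≤ n - i + 2 * i := by
    refine natDegree_mul_le.trans ?_
    rw [hdeg]
    gcongr
    exact natDegree_C_mul_X_pow_le _ _
  have hle : s.natDegree ≤ 2 * n := by
    refine natDegree_sum_le_of_forall_le _ _ fun i hi => (hterm i).trans ?_
    have := Finset.mem_range.1 hi
    omega
  have hco : s.coeff (2 * n) = p.leadingCoeff := by
    rw [finsetSum_coeff, Finset.sum_range_succ, Finset.sum_eq_zero]
    · have := (hmon.pow n).coeff_natDegree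
      rw [hdeg] at this
      rw [zero_add, Nat.sub_self, pow_zero, mul_one, coeff_C_mul, this, mul_one]
      rfl
    · intro i hi
      have := Finset.mem_range.1 hi
      exact coeff_eq_zero_of_natDegree_lt ((hterm i).trans_lt (by omega))
  have hsd : s.natDegree = 2 * n := by
    rcases eq_or_ne p 0 with rfl | hp
    · simp only [natDegree_zero] at hn
      omega
    · exact natDegree_eq_of_le_of_coeff_ne_zero hle (by rwa [hco, leadingCoeff_ne_zero])
  refine ⟨s, hsd, by rw [leadingCoeff, hsd, hco], ?_⟩
  conv_rhs => rw [p.as_sum_range_C_mul_X_pow]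
  simp only [s, map_sum, map_mul, map_pow, map_add, map_one, intEmb_X, intEmb_C, uHom_X, uHom_C,
    Finset.mul_sum]
  refine Finset.sum_congr rfl fun i hi => ?_
  have hi := Finset.mem_range.1 hi
  have h1 : (ν ^ 2 + 1) = ν * (ν + ν⁻¹) := by
    have := nu_ne_zero
    field_simp
  have h2 : ν ^ n = ν ^ (n - i) * ν ^ i := by rw [← pow_add]; congr 1; omega
  rw [h1, h2, mul_pow]
  ring

/-- The Laurent polynomial `ν ^ n + ν ^ (-n)` is an integer polynomial in `ν + ν⁻¹`. -/
lemma exists_uHom_eq_pow_add (n : ℕ) : ∃ c : ℤ[X], uHom c = ν ^ n + ν⁻¹ ^ n := by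
  induction n using Nat.twoStepInduction with
  | zero => exact ⟨2, by rw [map_ofNat]; norm_num⟩
  | one => exact ⟨X, by simp⟩
  | more n h1 h2 =>
    obtain ⟨a, ha⟩ := h1
    obtain ⟨b, hb⟩ := h2
    refine ⟨X * b - a, ?_⟩
    have h : ν * ν⁻¹ = 1 := mul_inv_cancel₀ nu_ne_zero
    rw [map_sub, map_mul, ha, hb, uHom_X]
    linear_combination (ν ^ n + ν⁻¹ ^ n) * h

lemma exists_uHom_eq_of_coeff_symm {P : ℤ[X]} {N : ℕ} (hP : P.natDegree ≤ 2 * N)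
    (hsymm : ∀ i ≤ 2 * N, P.coeff i = P.coeff (2 * N - i)) :
    ∃ q : ℤ[X], ν ^ N * uHom q = intEmb P := by
  choose c hc using exists_uHom_eq_pow_add
  refine ⟨C (P.coeff N) + ∑ j ∈ Finset.range N, C (P.coeff j) * c (N - j), ?_⟩
  conv_rhs => rw [P.as_sum_range' (N + 1 + N) (by omega), Finset.sum_range_add,
    Finset.sum_range_succ, ← Finset.sum_range_reflect (fun j => monomial (N + 1 + j) _) N]
  simp only [map_sum, map_mul, map_add, hc, uHom_C, Finset.mul_sum, mul_add,
    Finset.sum_add_distrib, ← C_mul_X_pow_eq_monomial, map_pow, intEmb_X, intEmb_C]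
  have h1 : ∑ j ∈ Finset.range N, ν ^ N * ((P.coeff j : RatFunc ℚ) * ν ^ (N - j)) =
      ∑ j ∈ Finset.range N, (P.coeff (N + 1 + (N - 1 - j)) : RatFunc ℚ) *
        ν ^ (N + 1 + (N - 1 - j)) := by
    refine Finset.sum_congr rfl fun j hj => ?_
    have := Finset.mem_range.1 hj
    have h : N + 1 + (N - 1 - j) = 2 * N - j := by omega
    rw [h, hsymm j (by omega), show 2 * N - j = N + (N - j) by omega, pow_add]
    ring
  have h2 : ∑ j ∈ Finset.range N, ν ^ N * ((P.coeff j : RatFunc ℚ) * ν⁻¹ ^ (N - j)) =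
      ∑ j ∈ Finset.range N, (P.coeff j : RatFunc ℚ) * ν ^ j := by
    refine Finset.sum_congr rfl fun j hj => ?_
    have := Finset.mem_range.1 hj
    have hv := nu_ne_zero
    have h : ν ^ N = ν ^ j * ν ^ (N - j) := by rw [← pow_add]; congr 1; omega
    rw [h, inv_pow]
    field_simp
  rw [h1, h2]
  ring

lemma exists_uHom_eq_mul_mirror (D : ℤ[X]) : ∃ (q : ℤ[X]) (N : ℕ),
    ν ^ N * uHom q = intEmb (D * D.mirror) := by
  have hd := D.natDegree_mul_mirror
  have ht := D.natTrailingDegree_mul_mirror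
  have hm : (D * D.mirror).mirror = D * D.mirror := by
    rw [mirror_mul_of_domain, mirror_mirror, mul_comm]
  have hle := (D * D.mirror).natTrailingDegree_le_natDegree
  set P := D * D.mirror
  obtain ⟨q, hq⟩ := exists_uHom_eq_of_coeff_symm (P := P)
    (N := D.natDegree + D.natTrailingDegree) (by omega) (by
      intro i hi
      conv_lhs => rw [← hm]
      rw [coeff_mirror, hd, ht, ← mul_add, revAt_le hi])
  exact ⟨q, _, hq⟩

lemma cyclotomic_reverse {k : ℕ} (hk : 2 ≤ k) :
    (cyclotomic k ℤ).reverse = cyclotomic k ℤ := by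
  have hk0 : 0 < k := by omega
  have hζ := Complex.isPrimitiveRoot_exp k hk0.ne'
  set ζ := Complex.exp (2 * Real.pi * Complex.I / k)
  have hζ0 : ζ ≠ 0 := hζ.ne_zero hk0.ne'
  have hc0 : (cyclotomic k ℤ).coeff 0 = 1 := cyclotomic_coeff_zero ℤ (by omega)
  have hroot : aeval ζ (cyclotomic k ℤ).reverse = 0 := by
    let : Invertible ζ⁻¹ := invertibleOfNonzero (inv_ne_zero hζ0)
    have h := eval₂_reverse_eq_zero_iff (algebraMap ℤ ℂ) ζ⁻¹ (cyclotomic k ℤ)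
    rw [invOf_eq_inv, inv_inv] at h
    rw [aeval_def, h, ← aeval_def, cyclotomic_eq_minpoly hζ.inv hk0]
    exact minpoly.aeval _ _
  have hdvd : cyclotomic k ℤ ∣ (cyclotomic k ℤ).reverse := by
    rw [cyclotomic_eq_minpoly hζ hk0] at hroot ⊢
    exact minpoly.isIntegrallyClosed_dvd (hζ.isIntegral hk0) hroot
  have ht : (cyclotomic k ℤ).natTrailingDegree = 0 :=
    natTrailingDegree_eq_zero.2 (.inr (by simp [hc0]))
  have hmon : (cyclotomic k ℤ).reverse.Monic := by
    rw [Monic, reverse_leadingCoeff, trailingCoeff, ht, hc0]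
  exact eq_of_monic_of_dvd_of_natDegree_le (cyclotomic.monic k ℤ) hmon hdvd
    (reverse_natDegree_le _)


/-- The `k`-th normalized cyclotomic factor in `ℤ[ν + ν⁻¹]`. -/
def cycFactor (k : ℕ) : RatFunc ℚ :=
  if k = 1 then ν + ν⁻¹ - 2 else if k = 2 then ν + ν⁻¹ + 2 else
    ν⁻¹ ^ (Nat.totient k / 2) * intEmb (cyclotomic k ℤ)

lemma exists_monic_irreducible_of_three_le {k : ℕ} (hk : 3 ≤ k) : ∃ ψ : ℤ[X],
    ψ.Monic ∧ Irreducible ψ ∧ ν ^ (Nat.totient k / 2) * uHom ψ = intEmb (cyclotomic k ℤ) := by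
  have hdeg := natDegree_cyclotomic k ℤ
  have heven := Nat.two_mul_div_two_of_even (Nat.totient_even hk)
  set N := Nat.totient k / 2
  have hirr : Irreducible (cyclotomic k ℤ) := cyclotomic.irreducible (by omega)
  obtain ⟨q, hq⟩ := exists_uHom_eq_of_coeff_symm (P := cyclotomic k ℤ) (N := N)
    (by omega) fun i hi => by
      conv_lhs => rw [← cyclotomic_reverse (k := k) (by omega)]
      rw [coeff_reverse, hdeg, ← heven, revAt_le hi]
  have hq0 : q ≠ 0 := by
    rintro rfl
    rw [map_zero, mul_zero, eq_comm, map_eq_zero_iff _ intEmb_injective] at hq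
    exact cyclotomic_ne_zero k ℤ hq
  obtain ⟨s, hs1, hs2, hs3⟩ := exists_intEmb_eq q
  have hs0 : s ≠ 0 := by
    rintro rfl
    exact hq0 (leadingCoeff_eq_zero.1 (by rw [← hs2, leadingCoeff_zero]))
  have key : X ^ N * s = X ^ q.natDegree * cyclotomic k ℤ := by
    apply intEmb_injective
    simp only [map_mul, map_pow, intEmb_X, hs3, ← hq]
    ring
  have hN : q.natDegree = N := by
    have := congrArg natDegree key
    rw [natDegree_mul (by simp) hs0, natDegree_mul (by simp) (cyclotomic_ne_zero k ℤ),
      natDegree_X_pow, natDegree_X_pow, hdeg, hs1] at this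
    omega
  have hsk : s = cyclotomic k ℤ := by
    rw [hN] at key
    exact mul_left_cancel₀ (by simp) key
  have hmon : q.Monic := by
    rw [Monic, ← hs2, hsk]
    exact cyclotomic.monic k ℤ
  refine ⟨q, hmon, (hmon.irreducible_iff_natDegree).2 ⟨?_, fun f g hf hg hfg => ?_⟩, hq⟩
  · rintro rfl
    have := Nat.totient_pos.2 (show 0 < k by omega)
    rw [natDegree_one] at hN
    omega
  · obtain ⟨sf, hf1, -, hf3⟩ := exists_intEmb_eq f
    obtain ⟨sg, hg1, -, hg3⟩ := exists_intEmb_eq g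
    have : cyclotomic k ℤ = sf * sg := by
      apply intEmb_injective
      rw [← hq, map_mul, hf3, hg3, ← hfg, ← hN, ← hfg, hf.natDegree_mul hg, map_mul, pow_add]
      ring
    refine (hirr.isUnit_or_isUnit this).imp (fun h => ?_) fun h => ?_ <;>
    · have := natDegree_eq_zero_of_isUnit h
      omega

lemma exists_monic_irreducible {k : ℕ} (hk : 1 ≤ k) : ∃ ψ : ℤ[X], ψ.Monic ∧ Irreducible ψ ∧
    uHom ψ = cycFactor k ∧
    ∃ (N : ℕ) (R : ℤ[X]), ν ^ N * uHom ψ = intEmb (cyclotomic k ℤ * R) := by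
  have hν := nu_ne_zero
  have hlin (a : ℤ) : (X + C a).Monic ∧ Irreducible (X + C a) :=
    ⟨monic_X_add_C a, (monic_X_add_C a).irreducible_of_degree_eq_one (degree_X_add_C a)⟩
  obtain rfl | rfl | hk3 : k = 1 ∨ k = 2 ∨ 3 ≤ k := by omega
  · refine ⟨X + C (-2), (hlin _).1, (hlin _).2, ?_, 1, X - 1, ?_⟩
    · rw [map_add, uHom_X, uHom_C, cycFactor, if_pos rfl, Int.cast_neg,
        Int.cast_ofNat, sub_eq_add_neg]
    · simp only [cyclotomic_one, map_mul, map_sub, map_add, map_one, intEmb_X, uHom_X, uHom_C]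
      push_cast
      field_simp
      ring
  · refine ⟨X + C 2, (hlin _).1, (hlin _).2, ?_, 1, X + 1, ?_⟩
    · rw [map_add, uHom_X, uHom_C, cycFactor, if_neg (by decide), if_pos rfl, Int.cast_ofNat]
    · simp only [cyclotomic_two, map_mul, map_add, map_one, intEmb_X, uHom_X, uHom_C]
      push_cast
      field_simp
      ring
  · obtain ⟨ψ, h1, h2, h3⟩ := exists_monic_irreducible_of_three_le hk3
    refine ⟨ψ, h1, h2, ?_, _, 1, by rw [mul_one, h3]⟩
    rw [cycFactor, if_neg (by omega), if_neg (by omega), ← h3, inv_pow, inv_mul_cancel_left₀]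
    exact pow_ne_zero _ hν

/-- `q` is nonzero and each of its prime factors is constant or associated to some `ψ k`,
`1 ≤ k`. -/
def PrimeFactorsIn (ψ : ℕ → ℤ[X]) (q : ℤ[X]) : Prop :=
  q ≠ 0 ∧ ∀ π, Prime π → π ∣ q → π.natDegree = 0 ∨ ∃ k, 1 ≤ k ∧ Associated π (ψ k)

namespace PrimeFactorsIn

variable {ψ : ℕ → ℤ[X]} {p q : ℤ[X]}

lemma C {a : ℤ} (ha : a ≠ 0) : PrimeFactorsIn ψ (C a) := by
  refine ⟨by simpa using ha, fun π _ hπ => .inl ?_⟩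
  have := natDegree_le_of_dvd hπ (by simpa using ha)
  simpa using this

lemma one : PrimeFactorsIn ψ 1 := by simpa using C (ψ := ψ) one_ne_zero

lemma mul (hp : PrimeFactorsIn ψ p) (hq : PrimeFactorsIn ψ q) : PrimeFactorsIn ψ (p * q) :=
  ⟨mul_ne_zero hp.1 hq.1, fun π hπ h => (hπ.dvd_or_dvd h).elim (hp.2 π hπ) (hq.2 π hπ)⟩

lemma of_dvd (hq : PrimeFactorsIn ψ q) (h : p ∣ q) : PrimeFactorsIn ψ p :=
  ⟨ne_zero_of_dvd_ne_zero hq.1 h, fun π hπ h' => hq.2 π hπ (h'.trans h)⟩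

lemma pow (hq : PrimeFactorsIn ψ q) (n : ℕ) : PrimeFactorsIn ψ (q ^ n) :=
  ⟨pow_ne_zero _ hq.1, fun π hπ h => hq.2 π hπ (hπ.dvd_of_dvd_pow h)⟩

lemma prod {s : Finset ℕ} (hs : ∀ k ∈ s, 1 ≤ k) (hψ : ∀ k, 1 ≤ k → Irreducible (ψ k)) :
    PrimeFactorsIn ψ (∏ k ∈ s, ψ k) := by
  refine Finset.prod_induction _ _ (fun _ _ => mul) one fun k hk => ⟨(hψ k (hs k hk)).ne_zero, ?_⟩
  exact fun π hπ h => .inr ⟨k, hs k hk, hπ.irreducible.associated_of_dvd (hψ k (hs k hk)) h⟩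

lemma exists_eq_C_mul_prod (hq : PrimeFactorsIn ψ q) : ∃ (a : ℤ) (s : Multiset ℕ),
    (∀ k ∈ s, 1 ≤ k) ∧ q = Polynomial.C a * (s.map ψ).prod := by
  induction q using UniqueFactorizationMonoid.induction_on_prime with
  | h₁ => exact absurd rfl hq.1
  | h₂ x hx =>
    refine ⟨x.coeff 0, 0, by simp, ?_⟩
    simpa using eq_C_of_natDegree_eq_zero (natDegree_eq_zero_of_isUnit hx)
  | h₃ x π _ hπ ih =>
    obtain ⟨a, s, hs, rfl⟩ := ih (hq.of_dvd (dvd_mul_left _ _))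
    rcases hq.2 π hπ (dvd_mul_right _ _) with h | ⟨k, hk, h⟩
    · refine ⟨π.coeff 0 * a, s, hs, ?_⟩
      conv_lhs => rw [eq_C_of_natDegree_eq_zero h]
      rw [C_mul, mul_assoc]
    · obtain ⟨u, hu⟩ := h.symm
      refine ⟨(u : ℤ[X]).coeff 0 * a, k ::ₘ s, by simpa [hk] using hs, ?_⟩
      rw [← hu, C_mul, ← eq_C_of_natDegree_eq_zero (natDegree_eq_zero_of_isUnit u.isUnit),
        Multiset.map_cons, Multiset.prod_cons]
      ring

end PrimeFactorsIn

lemma IsIntLaurent.sub {x y : RatFunc ℚ} (hx : IsIntLaurent x) (hy : IsIntLaurent y) :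
    IsIntLaurent (x - y) := by
  obtain ⟨p, m, hp⟩ := hx
  obtain ⟨q, n, hq⟩ := hy
  change _ = intEmb p at hp
  change _ = intEmb q at hq
  refine ⟨X ^ n * p - X ^ m * q, m + n, ?_⟩
  change _ = intEmb _
  simp only [map_sub, map_mul, map_pow, intEmb_X, ← hp, ← hq]
  ring

lemma IsIntLaurent.uHom_mul {x : RatFunc ℚ} (hx : IsIntLaurent x) (r : ℤ[X]) :
    IsIntLaurent (uHom r * x) := by
  obtain ⟨p, m, hp⟩ := hx
  change _ = intEmb p at hp
  obtain ⟨s, -, -, hs⟩ := exists_intEmb_eq r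
  refine ⟨s * p, r.natDegree + m, ?_⟩
  change _ = intEmb _
  rw [map_mul, hs, ← hp]
  ring

section Clears

variable {F : Finset (RatFunc ℚ)} {p q : ℤ[X]}

lemma Clears.sub (hp : Clears F p) (hq : Clears F q) : Clears F (p - q) := fun f hf => by
  rw [evalAtU_eq, map_sub, sub_mul]
  exact (hp f hf).sub (hq f hf)

lemma Clears.mul_left (hp : Clears F p) (r : ℤ[X]) : Clears F (r * p) := fun f hf => by
  rw [evalAtU_eq, map_mul, mul_assoc]
  exact (hp f hf).uHom_mul r

lemma exists_isIntLaurent_of_denom_dvd {f : RatFunc ℚ} {N : ℕ} {P : ℤ[X]}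
    (hq : ν ^ N * uHom q = intEmb P) (hP : f.denom ∣ P.map (Int.castRingHom ℚ)) :
    ∃ b : ℤ, b ≠ 0 ∧ IsIntLaurent (uHom (C b * q) * f) := by
  obtain ⟨g, hg⟩ := hP
  obtain ⟨b, hb, hs⟩ :=
    IsLocalization.integerNormalization_spec (nonZeroDivisors ℤ) (g * f.num)
  refine ⟨b, nonZeroDivisors.ne_zero hb,
    IsLocalization.integerNormalization (nonZeroDivisors ℤ) (g * f.num), N, ?_⟩
  change _ = intEmb _
  have hd : algebraMap ℚ[X] (RatFunc ℚ) f.denom ≠ 0 :=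
    RatFunc.algebraMap_ne_zero f.denom_ne_zero
  have hf : f * algebraMap ℚ[X] (RatFunc ℚ) f.denom = algebraMap _ _ f.num := by
    nth_rw 1 [← RatFunc.num_div_denom f]
    exact div_mul_cancel₀ _ hd
  rw [intEmb_apply, hg, map_mul] at hq
  rw [intEmb_apply, ← algebraMap_int_eq, hs, map_zsmul, zsmul_eq_mul, map_mul, map_mul, uHom_C,
    ← hf]
  linear_combination (b : RatFunc ℚ) * f * hq

lemma exists_clears (G : ℤ[X] → Prop) (h1 : G 1) (hmul : ∀ p q, G p → G q → G (p * q))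
    (h : ∀ f ∈ F, ∃ q, G q ∧ IsIntLaurent (uHom q * f)) : ∃ q, G q ∧ Clears F q := by
  classical
  induction F using Finset.induction_on with
  | empty => exact ⟨1, h1, by simp [Clears]⟩
  | insert f F _ ih =>
    obtain ⟨q, hq, hqF⟩ := ih fun g hg => h g (Finset.mem_insert_of_mem hg)
    obtain ⟨r, hr, hrf⟩ := h f (Finset.mem_insert_self _ _)
    refine ⟨r * q, hmul _ _ hr hq, fun g hg => ?_⟩
    obtain rfl | hg := Finset.mem_insert.1 hg
    · rw [evalAtU_eq, mul_comm r q, map_mul, mul_assoc]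
      exact hrf.uHom_mul q
    · exact hqF.mul_left r g hg

lemma exists_ne_zero_clears (F : Finset (RatFunc ℚ)) : ∃ q, q ≠ 0 ∧ Clears F q := by
  refine exists_clears (· ≠ 0) one_ne_zero (fun _ _ => mul_ne_zero) fun f _ => ?_
  obtain ⟨b, hb, hs⟩ := IsLocalization.integerNormalization_spec (nonZeroDivisors ℤ) f.denom
  set D := IsLocalization.integerNormalization (nonZeroDivisors ℤ) f.denom
  have hD0 : D ≠ 0 :=
    mt IsFractionRing.integerNormalization_eq_zero_iff.1 f.denom_ne_zero
  obtain ⟨q, N, hq⟩ := exists_uHom_eq_mul_mirror D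
  have hq0 : q ≠ 0 := by
    rintro rfl
    rw [map_zero, mul_zero, eq_comm, map_eq_zero_iff _ intEmb_injective] at hq
    exact mul_ne_zero hD0 (mirror_eq_zero.not.2 hD0) hq
  obtain ⟨c, hc, h⟩ := exists_isIntLaurent_of_denom_dvd (f := f) hq (by
    rw [Polynomial.map_mul, ← algebraMap_int_eq, hs, zsmul_eq_mul]
    exact (dvd_mul_left _ _).mul_right _)
  exact ⟨_, mul_ne_zero (by simpa using hc) hq0, h⟩

/-- A polynomial of minimal degree among those clearing `F` divides all of them up to a nonzero
integer. -/
lemma dvd_C_mul_of_clears (hp0 : p ≠ 0) (hp : Clears F p)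
    (hmin : ∀ r, r ≠ 0 → Clears F r → p.degree ≤ r.degree) (hq : Clears F q) :
    ∃ N : ℤ, N ≠ 0 ∧ p ∣ C N * q := by
  induction hn : q.natDegree using Nat.strong_induction_on generalizing q with
  | _ n ih =>
    rcases eq_or_ne q 0 with rfl | hq0
    · exact ⟨1, one_ne_zero, by simp⟩
    have hle := natDegree_le_natDegree (hmin q hq0 hq)
    have hlc : p.leadingCoeff ≠ 0 := leadingCoeff_ne_zero.2 hp0
    rcases Nat.eq_zero_or_pos q.natDegree with h0 | hpos
    · rw [h0, Nat.le_zero] at hle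
      refine ⟨p.coeff 0, by simpa [leadingCoeff, hle] using hlc, ?_⟩
      rw [← eq_C_of_natDegree_eq_zero hle]
      exact dvd_mul_right _ _
    have hc : Clears F (p.cancelLeads q) := (hq.mul_left _).sub (hp.mul_left _)
    obtain ⟨N, hN, hd⟩ := ih _ (hn ▸ natDegree_cancelLeads_lt_of_natDegree_le_natDegree hle hpos)
      hc rfl
    refine ⟨N * p.leadingCoeff, mul_ne_zero hN hlc, ?_⟩
    rw [cancelLeads, Nat.sub_eq_zero_of_le hle, pow_zero, mul_one, mul_sub,
      dvd_sub_left (dvd_mul_of_dvd_right (dvd_mul_left _ _) _), ← mul_assoc, ← C_mul] at hd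
    exact hd

lemma exists_isDF (F : Finset (RatFunc ℚ)) : ∃ p, IsDF F p := by
  obtain ⟨q, hq0, hq⟩ := exists_ne_zero_clears F
  let S : Set ℤ[X] := {q | Clears F q ∧ 0 < q.leadingCoeff}
  have hS {q : ℤ[X]} (hq0 : q ≠ 0) (hq : Clears F q) : ∃ r ∈ S, r.degree = q.degree := by
    rcases (leadingCoeff_ne_zero.2 hq0).lt_or_gt with h | h
    · exact ⟨-q, ⟨by simpa using hq.mul_left (-1), by simpa using h⟩, degree_neg q⟩
    · exact ⟨q, ⟨hq, h⟩, rfl⟩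
  obtain ⟨r, hr, -⟩ := hS hq0 hq
  let key : ℤ[X] → ℕ ×ₗ ℕ := fun q => toLex (q.natDegree, q.leadingCoeff.toNat)
  obtain ⟨p, hp, hmin⟩ := WellFounded.has_min (InvImage.wf key wellFounded_lt) S ⟨r, hr⟩
  have hp0 : p ≠ 0 := leadingCoeff_ne_zero.1 hp.2.ne'
  refine ⟨p, hp.1, hp.2, fun q hq0 hq => ?_, fun q hq hlc hdeg => ?_⟩
  · obtain ⟨r, hr, hrq⟩ := hS hq0 hq
    rw [← hrq]
    by_contra! h
    refine hmin r hr (Prod.Lex.toLex_lt_toLex.2 (.inl ?_))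
    exact natDegree_lt_natDegree (leadingCoeff_ne_zero.1 hr.2.ne') h
  · by_contra! h
    exact hmin q ⟨hq, hlc⟩ (Prod.Lex.toLex_lt_toLex.2 (.inr ⟨natDegree_eq_of_degree_eq hdeg,
      by simpa using ⟨h, hp.2⟩⟩))

lemma IsDF.eq (hp : IsDF F p) (hq : IsDF F q) : q = p := by
  by_contra hne
  have hp0 : p ≠ 0 := leadingCoeff_ne_zero.1 hp.2.1.ne'
  have hq0 : q ≠ 0 := leadingCoeff_ne_zero.1 hq.2.1.ne'
  have hdeg : q.degree = p.degree :=
    (hq.2.2.1 p hp0 hp.1).antisymm (hp.2.2.1 q hq0 hq.1)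
  have hlc : q.leadingCoeff = p.leadingCoeff :=
    (hq.2.2.2 p hp.1 hp.2.1 hdeg.symm).antisymm (hp.2.2.2 q hq.1 hq.2.1 hdeg)
  exact (hq.2.2.1 _ (sub_ne_zero.2 hne) (hq.1.sub hp.1)).not_gt (degree_sub_lt_left hdeg hq0 hlc)

end Clears

lemma exists_dvd_pow_of_roots {d : ℚ[X]} (hd : d ≠ 0)
    (h : ∀ z : AlgebraicClosure ℚ, aeval z d = 0 → z ≠ 0 → ∃ m : ℕ, 0 < m ∧ z ^ m = 1) :
    ∃ M a : ℕ, 0 < M ∧ d ∣ (X * (X ^ M - 1)) ^ a := by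
  induction d using UniqueFactorizationMonoid.induction_on_prime with
  | h₁ => exact absurd rfl hd
  | h₂ d hu => exact ⟨1, 0, one_pos, hu.dvd⟩
  | h₃ d π hd0 hπ ih =>
    obtain ⟨M, a, hM, hdvd⟩ := ih hd0 fun z hz => h z (by rw [map_mul, hz, mul_zero])
    obtain ⟨z, hz⟩ := IsAlgClosed.exists_aeval_eq_zero (AlgebraicClosure ℚ) π
      (degree_pos_of_irreducible hπ.irreducible).ne'
    have hdvd_of {g : ℚ[X]} (hg : aeval z g = 0) : π ∣ g :=
      (minpoly.eq_of_irreducible hπ.irreducible hz ▸ Dvd.intro _ rfl : π ∣ minpoly ℚ z).trans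
        (minpoly.dvd ℚ z hg)
    obtain ⟨m, hm, hπm⟩ : ∃ m : ℕ, 0 < m ∧ π ∣ X * (X ^ m - 1) := by
      rcases eq_or_ne z 0 with rfl | hz0
      · exact ⟨1, one_pos, hdvd_of (by simp)⟩
      · obtain ⟨m, hm, hzm⟩ := h z (by rw [map_mul, hz, zero_mul]) hz0
        exact ⟨m, hm, hdvd_of (by simp [hzm])⟩
    refine ⟨m * M, a + 1, Nat.mul_pos hm hM, ?_⟩
    rw [pow_succ']
    refine mul_dvd_mul (hπm.trans (mul_dvd_mul_left _ ?_))
      (hdvd.trans (pow_dvd_pow_of_dvd (mul_dvd_mul_left _ ?_) _))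
    · exact pow_one_sub_dvd_pow_mul_sub_one X m M
    · rw [mul_comm]
      exact pow_one_sub_dvd_pow_mul_sub_one X M m

lemma exists_primeFactorsIn_isIntLaurent {ψ : ℕ → ℤ[X]} (hirr : ∀ k, 1 ≤ k → Irreducible (ψ k))
    (hψ : ∀ k, 1 ≤ k → ∃ (N : ℕ) (R : ℤ[X]), ν ^ N * uHom (ψ k) = intEmb (cyclotomic k ℤ * R))
    {f : RatFunc ℚ} (h : ∀ z : AlgebraicClosure ℚ,
      aeval z f.denom = 0 → z ≠ 0 → ∃ m : ℕ, 0 < m ∧ z ^ m = 1) :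
    ∃ q, PrimeFactorsIn ψ q ∧ IsIntLaurent (uHom q * f) := by
  obtain ⟨M, a, hM, hdvd⟩ := exists_dvd_pow_of_roots f.denom_ne_zero h
  choose! N R hNR using hψ
  have hpos : ∀ k ∈ M.divisors, 1 ≤ k := fun k hk => Nat.pos_of_mem_divisors hk
  obtain ⟨b, hb, hf⟩ := exists_isIntLaurent_of_denom_dvd (f := f)
    (q := (∏ k ∈ M.divisors, ψ k) ^ a) (N := (1 + ∑ k ∈ M.divisors, N k) * a)
    (P := (X * ((∏ k ∈ M.divisors, cyclotomic k ℤ) * ∏ k ∈ M.divisors, R k)) ^ a)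
    (by
      rw [pow_mul, map_pow, ← mul_pow, map_pow, map_mul, ← Finset.prod_mul_distrib, map_prod,
        map_prod, ← Finset.prod_congr rfl fun k hk => hNR k (hpos k hk), Finset.prod_mul_distrib,
        Finset.prod_pow_eq_pow_sum, intEmb_X, pow_add, pow_one, mul_assoc])
    (by
      refine hdvd.trans ?_
      rw [Polynomial.map_pow]
      refine pow_dvd_pow_of_dvd ?_ _
      rw [prod_cyclotomic_eq_X_pow_sub_one hM, ← mul_assoc, Polynomial.map_mul]
      simp)
  exact ⟨_, (PrimeFactorsIn.C hb).mul ((PrimeFactorsIn.prod hpos hirr).pow a), hf⟩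

end

/-- existence and uniqueness of `d(F) ∈ ℤ[ν+ν⁻¹]` for a finite `F ⊆ ℚ(ν)`;
moreover, if all the nonzero roots of the denominators (in lowest terms) of the members of `F`
are roots of unity, then `d(F)` is a positive integer multiple of a product of
`(ν+ν⁻¹-2)`, `(ν+ν⁻¹+2)` and normalized cyclotomic factors `ν^{-φ(k)/2} Φ_k(ν)`, `k ≥ 3`. -/
theorem statement3 (F : Finset (RatFunc ℚ)) :
    ∃ p : Polynomial ℤ, IsDF F p ∧ (∀ p' : Polynomial ℤ, IsDF F p' → p' = p) ∧
      ((∀ f ∈ F, ∀ z : AlgebraicClosure ℚ,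
          Polynomial.aeval z (RatFunc.denom f) = 0 → z ≠ 0 → ∃ m : ℕ, 0 < m ∧ z ^ m = 1) →
        ∃ (c : ℕ) (N : ℕ) (mf : ℕ → ℕ), 0 < c ∧
          evalAtU p = (c : RatFunc ℚ) *
            (RatFunc.X + (RatFunc.X)⁻¹ - 2) ^ (mf 1) *
            (RatFunc.X + (RatFunc.X)⁻¹ + 2) ^ (mf 2) *
            ∏ k ∈ Finset.Icc 3 N,
              (((RatFunc.X)⁻¹ ^ (Nat.totient k / 2)) *
                Polynomial.eval₂ (Int.castRingHom (RatFunc ℚ)) RatFunc.X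
                  (Polynomial.cyclotomic k ℤ)) ^ (mf k)) := by
  classical
  choose! ψ hmon hirr hcyc hψ using fun k (hk : 1 ≤ k) => exists_monic_irreducible hk
  obtain ⟨p, hp⟩ := exists_isDF F
  refine ⟨p, hp, fun q hq => hp.eq hq, fun h => ?_⟩
  obtain ⟨q, hq, hqF⟩ := exists_clears (F := F) (PrimeFactorsIn ψ) PrimeFactorsIn.one
    (fun _ _ => PrimeFactorsIn.mul)
    fun f hf => exists_primeFactorsIn_isIntLaurent hirr hψ (h f hf)
  obtain ⟨N, hN, hpN⟩ := dvd_C_mul_of_clears (Polynomial.leadingCoeff_ne_zero.1 hp.2.1.ne')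
    hp.1 hp.2.2.1 hqF
  obtain ⟨a, s, hs, hpa⟩ :=
    (((PrimeFactorsIn.C hN).mul hq).of_dvd hpN).exists_eq_C_mul_prod
  have hprod : (s.map ψ).prod.Monic :=
    Polynomial.monic_multiset_prod_of_monic s ψ fun k hk => hmon k (hs k hk)
  have ha : 0 < a := by
    have := hp.2.1
    rwa [hpa, Polynomial.leadingCoeff_mul_monic hprod, Polynomial.leadingCoeff_C] at this
  lift a to ℕ using ha.le
  have hIcc : Finset.Icc 1 (s.sum + 2) = insert 1 (insert 2 (Finset.Icc 3 (s.sum + 2))) := by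
    ext k
    simp only [Finset.mem_Icc, Finset.mem_insert]
    omega
  have hsub : s.toFinset ⊆ Finset.Icc 1 (s.sum + 2) := fun k hk => by
    have hk := Multiset.mem_toFinset.1 hk
    have := Multiset.le_sum_of_mem hk
    exact Finset.mem_Icc.2 ⟨hs k hk, by omega⟩
  refine ⟨a, s.sum + 2, s.count, by exact_mod_cast ha, ?_⟩
  rw [evalAtU_eq, hpa, map_mul, uHom_C, Finset.prod_multiset_map_count,
    Finset.prod_subset hsub fun k _ hk => by
      rw [Multiset.count_eq_zero.2 (mt Multiset.mem_toFinset.2 hk), pow_zero],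
    hIcc, Finset.prod_insert (by simp), Finset.prod_insert (by simp), map_mul, map_mul, map_pow,
    map_pow, hcyc 1 le_rfl, hcyc 2 one_le_two, map_prod, cycFactor, if_pos rfl, cycFactor,
    if_neg (by decide), if_pos rfl, Int.cast_natCast, ← mul_assoc, ← mul_assoc]
  congr 1
  refine Finset.prod_congr rfl fun k hk => ?_
  have hk := (Finset.mem_Icc.1 hk).1
  rw [map_pow, hcyc k (by omega), cycFactor, if_neg (by omega), if_neg (by omega)]
  rfl
end
end

section
/- Let A be an associative unital algebra over k = ℚ(q) containing elements E, F, K₊, K₋ satisfying the U_q(s̃l₂) relations, and let C⁽ᵐ⁾ be the Chebyshev-type central elements defined recursively from C = FE − qK₊ − q⁻¹K₋. Then for all integers m, k ≥ 0: F^k C⁽ᵐ⁾ = Σ_{a,b ≥ 0, a+b ≤ m} (−1)^{a+b} q^{(2k+1)(a−b)} · binom[q⁻²]{m−a}{b} · binom[q²]{m−b}{a} · K₊^a K₋^b F^{m+k−a−b} E^{m−a−b}, and C⁽ᵐ⁾ E^k = Σ_{a,b ≥ 0, a+b ≤ m} (−1)^{a+b} q^{(a−b)} · binom[q⁻²]{m−a}{b}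 · binom[q²]{m−b}{a} · K₊^a K₋^b F^{m−a−b} E^{m+k−a−b}. -/
noncomputable section

/-- The Gaussian binomial coefficient `binom[v]{a}{n} = ∏_{t=1}^{n} (v^{a-n+t} - 1)/(v^t - 1)`,
evaluated at `v ∈ ℚ(q)`. -/
def gbinom (v : RatFunc ℚ) (a n : ℕ) : RatFunc ℚ :=
  ∏ t ∈ Finset.range n, (v ^ (a - n + t + 1) - 1) / (v ^ (t + 1) - 1)

/-- The Chebyshev-type elements `C⁽⁰⁾ = 1`, `C⁽¹⁾ = C`,
`C⁽ᵐ⁺¹⁾ = C·C⁽ᵐ⁾ - K₊K₋·C⁽ᵐ⁻¹⁾` (for `m ≥ 1`), where `KK = K₊K₋`. -/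
def cheb {A : Type*} [Ring A] (C KK : A) : ℕ → A
  | 0 => 1
  | 1 => C
  | n + 2 => C * cheb C KK (n + 1) - KK * cheb C KK n

/-- The Gaussian binomial coefficient `binom[v]{n+a}{a}` as a product. -/
lemma gbinom_add (v : RatFunc ℚ) (n a : ℕ) :
    gbinom v (n + a) a = ∏ t ∈ Finset.range a, (v ^ (n + t + 1) - 1) / (v ^ (t + 1) - 1) := by
  simp [gbinom]

lemma gbinom_zero (v : RatFunc ℚ) (n : ℕ) : gbinom v n 0 = 1 := by
  simp [gbinom]

lemma gbinom_self {v : RatFunc ℚ} (hv : ∀ t : ℕ, v ^ (t + 1) - 1 ≠ 0) (a : ℕ) :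
    gbinom v a a = 1 := by
  have h := gbinom_add v 0 a
  rw [Nat.zero_add] at h
  rw [h]
  exact Finset.prod_eq_one fun t _ => by rw [Nat.zero_add]; exact div_self (hv t)

lemma gbinom_succ_left {v : RatFunc ℚ} (hv : ∀ t : ℕ, v ^ (t + 1) - 1 ≠ 0) (n a : ℕ) :
    gbinom v (n + 1 + a) a * (v ^ (n + 1) - 1) = gbinom v (n + a) a * (v ^ (n + a + 1) - 1) := by
  induction a with
  | zero => simp [gbinom_zero]
  | succ a ih =>
    simp only [gbinom_add, Finset.prod_range_succ] at ih ⊢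
    rw [mul_right_comm, ih]
    have := hv a
    field_simp
    ring

/-- The `q`-Pascal rule. -/
lemma gbinom_pascal {v : RatFunc ℚ} (hv : ∀ t : ℕ, v ^ (t + 1) - 1 ≠ 0) (n a : ℕ) :
    gbinom v (n + 1 + (a + 1)) (a + 1) =
      gbinom v (n + (a + 1)) (a + 1) + v ^ (n + 1) * gbinom v (n + 1 + a) a := by
  have h := gbinom_succ_left hv n a
  simp only [gbinom_add, Finset.prod_range_succ] at h ⊢
  have := hv a
  rw [mul_div_assoc', mul_div_assoc', ← h]
  field_simp
  ring

/-- Skew-commuting elements have skew-commuting powers. -/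
lemma pow_mul_pow_of_skew {A : Type*} [Ring A] [Algebra (RatFunc ℚ) A] {r : RatFunc ℚ} {x y : A}
    (h : x * y = r • (y * x)) (n m : ℕ) : x ^ n * y ^ m = r ^ (n * m) • (y ^ m * x ^ n) := by
  have h1 : ∀ n : ℕ, x ^ n * y = r ^ n • (y * x ^ n) := by
    intro n
    induction n with
    | zero => simp
    | succ n ih =>
      rw [pow_succ, mul_assoc, h, mul_smul_comm, ← mul_assoc, ih, smul_mul_assoc, smul_smul,
        mul_assoc, ← pow_succ']
  induction m with
  | zero => simp
  | succ m ih =>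
    rw [pow_succ, ← mul_assoc, ih, smul_mul_assoc, mul_assoc, h1, mul_smul_comm, smul_smul,
      ← mul_assoc, ← pow_add, mul_add, mul_one]

lemma sum_range_shift {A : Type*} [AddCommMonoid A] (u : ℕ → A) (M : ℕ) (h : u M = 0) :
    ∑ a ∈ Finset.range (M + 1), (if a = 0 then 0 else u (a - 1)) =
      ∑ a ∈ Finset.range (M + 1), u a := by
  rw [Finset.sum_range_succ', Finset.sum_range_succ u, h]
  simp

/-- Summation of a two-variable recurrence with shifts in each variable. -/
lemma sum_sum_of_recurrence {A : Type*} [AddCommGroup A] (f u₁ u₂ u₃ u₄ : ℕ → ℕ → A) (M : ℕ)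
    (h₀₀ : f 0 0 = u₁ 0 0) (h₁₀ : ∀ a, f (a + 1) 0 = u₁ (a + 1) 0 - u₂ a 0)
    (h₀₁ : ∀ b, f 0 (b + 1) = u₁ 0 (b + 1) - u₃ 0 b)
    (h₁₁ : ∀ a b, f (a + 1) (b + 1) =
      u₁ (a + 1) (b + 1) - u₂ a (b + 1) - u₃ (a + 1) b - u₄ a b)
    (h₂ : ∀ b, u₂ M b = 0) (h₃ : ∀ a, u₃ a M = 0) (h₄ : ∀ b, u₄ M b = 0)
    (h₄' : ∀ a, u₄ a M = 0) :
    ∑ a ∈ Finset.range (M + 1), ∑ b ∈ Finset.range (M + 1), f a b =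
      ∑ a ∈ Finset.range (M + 1), ∑ b ∈ Finset.range (M + 1),
        (u₁ a b - u₂ a b - u₃ a b - u₄ a b) := by
  have key : ∀ a b, f a b = u₁ a b - (if a = 0 then 0 else u₂ (a - 1) b) -
      (if b = 0 then 0 else u₃ a (b - 1)) -
      (if a = 0 then 0 else if b = 0 then 0 else u₄ (a - 1) (b - 1)) := by
    rintro (_ | a) (_ | b) <;> simp [h₀₀, h₁₀, h₀₁, h₁₁]
  have e₂ : ∑ a ∈ Finset.range (M + 1), ∑ b ∈ Finset.range (M + 1),
      (if a = 0 then 0 else u₂ (a - 1) b) =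
      ∑ a ∈ Finset.range (M + 1), ∑ b ∈ Finset.range (M + 1), u₂ a b := by
    rw [Finset.sum_comm, Finset.sum_comm (f := u₂)]
    exact Finset.sum_congr rfl fun b _ => sum_range_shift (fun a => u₂ a b) M (h₂ b)
  have e₃ : ∑ a ∈ Finset.range (M + 1), ∑ b ∈ Finset.range (M + 1),
      (if b = 0 then 0 else u₃ a (b - 1)) =
      ∑ a ∈ Finset.range (M + 1), ∑ b ∈ Finset.range (M + 1), u₃ a b :=
    Finset.sum_congr rfl fun a _ => sum_range_shift (u₃ a) M (h₃ a)
  have e₄ : ∑ a ∈ Finset.range (M + 1), ∑ b ∈ Finset.range (M + 1),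
      (if a = 0 then 0 else if b = 0 then 0 else u₄ (a - 1) (b - 1)) =
      ∑ a ∈ Finset.range (M + 1), ∑ b ∈ Finset.range (M + 1), u₄ a b := by
    rw [Finset.sum_comm, Finset.sum_comm (f := u₄),
      ← sum_range_shift (fun b => ∑ a ∈ Finset.range (M + 1), u₄ a b) M
        (Finset.sum_eq_zero fun a _ => h₄' a)]
    refine Finset.sum_congr rfl fun b _ => ?_
    rcases b with _ | b
    · simp
    · simpa using sum_range_shift (fun a => u₄ a b) M (h₄ b)
  simp only [key, Finset.sum_sub_distrib, e₂, e₃, e₄]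

/-- A sum over a triangle as a sum over a square. -/
lemma sum_triangle {A : Type*} [AddCommMonoid A] (f : ℕ → ℕ → A) (m M : ℕ) (hM : m < M) :
    ∑ a ∈ Finset.range (m + 1), ∑ b ∈ Finset.range (m + 1 - a), f a b =
      ∑ a ∈ Finset.range M, ∑ b ∈ Finset.range M, if a + b ≤ m then f a b else 0 := by
  have h : ∀ a, ∑ b ∈ Finset.range M, (if a + b ≤ m then f a b else 0) =
      ∑ b ∈ Finset.range (m + 1 - a), f a b := by
    intro a
    rw [← Finset.sum_filter]
    refine Finset.sum_congr ?_ fun _ _ => rfl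
    ext b
    simp only [Finset.mem_filter, Finset.mem_range]
    omega
  simp only [h]
  refine Finset.sum_subset (fun a => by simp only [Finset.mem_range]; omega) fun a _ ha => ?_
  have : m + 1 - a = 0 := by simp only [Finset.mem_range] at ha; omega
  simp [this]

/-- The coefficient of `K₊^a K₋^b F^n E^n` in `C⁽ᵃ⁺ᵇ⁺ⁿ⁾`. -/
def chebCoeff (q : RatFunc ℚ) (a b n : ℕ) : RatFunc ℚ :=
  (-1) ^ (a + b) * q ^ ((a : ℤ) - (b : ℤ)) * gbinom ((q ^ 2)⁻¹) (n + b) b *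
    gbinom (q ^ 2) (n + a) a

lemma chebCoeff_zero_zero (q : RatFunc ℚ) (n : ℕ) : chebCoeff q 0 0 n = 1 := by
  simp [chebCoeff, gbinom_zero]

lemma chebCoeff_succ_zero_zero {q : RatFunc ℚ} (hq : q ≠ 0)
    (hv : ∀ t : ℕ, (q ^ 2) ^ (t + 1) - 1 ≠ 0) (a : ℕ) :
    chebCoeff q (a + 1) 0 0 = -(chebCoeff q a 0 0 * q) := by
  simp only [chebCoeff, gbinom_zero, Nat.zero_add, gbinom_self hv]
  push_cast
  simp only [zpow_sub₀ hq, zpow_add₀ hq, zpow_natCast, zpow_one, zpow_zero]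
  ring

lemma chebCoeff_succ_zero_succ {q : RatFunc ℚ} (hq : q ≠ 0)
    (hv : ∀ t : ℕ, (q ^ 2) ^ (t + 1) - 1 ≠ 0) (a n : ℕ) :
    chebCoeff q (a + 1) 0 (n + 1) =
      chebCoeff q (a + 1) 0 n - chebCoeff q a 0 (n + 1) * q ^ (2 * (n + 1) + 1) := by
  simp only [chebCoeff, gbinom_zero, gbinom_pascal hv]
  push_cast
  simp only [zpow_sub₀ hq, zpow_add₀ hq, zpow_natCast, zpow_one, zpow_zero]
  ring

lemma chebCoeff_zero_succ_zero {q : RatFunc ℚ} (hq : q ≠ 0)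
    (hv' : ∀ t : ℕ, ((q ^ 2)⁻¹) ^ (t + 1) - 1 ≠ 0) (b : ℕ) :
    chebCoeff q 0 (b + 1) 0 = -(chebCoeff q 0 b 0 * q⁻¹) := by
  simp only [chebCoeff, gbinom_zero, Nat.zero_add, gbinom_self hv']
  push_cast
  simp only [zpow_sub₀ hq, zpow_add₀ hq, zpow_natCast, zpow_one, zpow_zero]
  field_simp
  ring

lemma chebCoeff_zero_succ_succ {q : RatFunc ℚ} (hq : q ≠ 0)
    (hv' : ∀ t : ℕ, ((q ^ 2)⁻¹) ^ (t + 1) - 1 ≠ 0) (b n : ℕ) :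
    chebCoeff q 0 (b + 1) (n + 1) =
      chebCoeff q 0 (b + 1) n - chebCoeff q 0 b (n + 1) * q⁻¹ ^ (2 * (n + 1) + 1) := by
  simp only [chebCoeff, gbinom_zero, gbinom_pascal hv']
  push_cast
  simp only [zpow_sub₀ hq, zpow_add₀ hq, zpow_natCast, zpow_one, zpow_zero, inv_pow]
  field_simp
  ring

lemma chebCoeff_succ_succ_zero {q : RatFunc ℚ} (hq : q ≠ 0)
    (hv : ∀ t : ℕ, (q ^ 2) ^ (t + 1) - 1 ≠ 0)
    (hv' : ∀ t : ℕ, ((q ^ 2)⁻¹) ^ (t + 1) - 1 ≠ 0) (a b : ℕ) :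
    chebCoeff q (a + 1) (b + 1) 0 =
      -(chebCoeff q a (b + 1) 0 * q) - chebCoeff q (a + 1) b 0 * q⁻¹ - chebCoeff q a b 0 := by
  simp only [chebCoeff, Nat.zero_add, gbinom_self hv, gbinom_self hv']
  push_cast
  simp only [zpow_sub₀ hq, zpow_add₀ hq, zpow_natCast, zpow_one]
  field_simp
  ring

lemma chebCoeff_succ_succ_succ {q : RatFunc ℚ} (hq : q ≠ 0)
    (hv : ∀ t : ℕ, (q ^ 2) ^ (t + 1) - 1 ≠ 0)
    (hv' : ∀ t : ℕ, ((q ^ 2)⁻¹) ^ (t + 1) - 1 ≠ 0) (a b n : ℕ) :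
    chebCoeff q (a + 1) (b + 1) (n + 1) =
      chebCoeff q (a + 1) (b + 1) n - chebCoeff q a (b + 1) (n + 1) * q ^ (2 * (n + 1) + 1) -
        chebCoeff q (a + 1) b (n + 1) * q⁻¹ ^ (2 * (n + 1) + 1) - chebCoeff q a b (n + 1) := by
  simp only [chebCoeff, gbinom_pascal hv, gbinom_pascal hv']
  push_cast
  simp only [zpow_sub₀ hq, zpow_add₀ hq, zpow_natCast, zpow_one, inv_pow]
  field_simp
  ring

/-- The expansion of `C⁽ᵐ⁾` from the rule for multiplying an ordered monomial `W a b n`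
(standing for `K₊^a K₋^b F^n E^n`) by `C` and by `K₊K₋`. -/
lemma cheb_eq_sum {A : Type*} [Ring A] [Algebra (RatFunc ℚ) A] {q : RatFunc ℚ} (hq : q ≠ 0)
    (hv : ∀ t : ℕ, (q ^ 2) ^ (t + 1) - 1 ≠ 0) (hv' : ∀ t : ℕ, ((q ^ 2)⁻¹) ^ (t + 1) - 1 ≠ 0)
    (C D : A) (W : ℕ → ℕ → ℕ → A) (hW : W 0 0 0 = 1)
    (hC : ∀ a b n, C * W a b n = W a b (n + 1) - q ^ (2 * n + 1) • W (a + 1) b n -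
      q⁻¹ ^ (2 * n + 1) • W a (b + 1) n)
    (hD : ∀ a b n, D * W a b n = W (a + 1) (b + 1) n) (m : ℕ) :
    ∀ M, m < M → cheb C D m = ∑ a ∈ Finset.range M, ∑ b ∈ Finset.range M,
      if a + b ≤ m then chebCoeff q a b (m - a - b) • W a b (m - a - b) else 0 := by
  induction m using Nat.twoStepInduction with
  | zero =>
    intro M hM
    rw [← sum_triangle (fun a b => chebCoeff q a b (0 - a - b) • W a b (0 - a - b)) 0 M hM]
    simp [cheb, chebCoeff_zero_zero, hW]
  | one =>
    intro M hM
    rw [← sum_triangle (fun a b => chebCoeff q a b (1 - a - b) • W a b (1 - a - b)) 1 M hM]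
    have h := hC 0 0 0
    have h1 := chebCoeff_succ_zero_zero hq hv 0
    have h2 := chebCoeff_zero_succ_zero hq hv' 0
    simp only [chebCoeff_zero_zero, hW, Nat.zero_add] at h h1 h2
    simp [cheb, Finset.sum_range_succ, chebCoeff_zero_zero, h1, h2] at h ⊢
    rw [h]
    abel
  | more m ih ih' =>
    intro M hM
    obtain ⟨M, rfl⟩ : ∃ M', M = M' + 1 := ⟨M - 1, by omega⟩
    rw [cheb, ih (M + 1) (by omega), ih' (M + 1) (by omega)]
    simp only [Finset.mul_sum, ← Finset.sum_sub_distrib]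
    symm
    rw [sum_sum_of_recurrence _
      (fun a b => if a + b ≤ m + 1 then
        chebCoeff q a b (m + 1 - a - b) • W a b (m + 1 - a - b + 1) else 0)
      (fun a b => if a + b ≤ m + 1 then
        (chebCoeff q a b (m + 1 - a - b) * q ^ (2 * (m + 1 - a - b) + 1)) •
          W (a + 1) b (m + 1 - a - b) else 0)
      (fun a b => if a + b ≤ m + 1 then
        (chebCoeff q a b (m + 1 - a - b) * q⁻¹ ^ (2 * (m + 1 - a - b) + 1)) •
          W a (b + 1) (m + 1 - a - b) else 0)
      (fun a b => if a + b ≤ m then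
        chebCoeff q a b (m - a - b) • W (a + 1) (b + 1) (m - a - b) else 0)]
    · refine Finset.sum_congr rfl fun a _ => Finset.sum_congr rfl fun b _ => ?_
      symm
      congr 1
      · split_ifs
        · rw [mul_smul_comm, hC]
          simp only [smul_sub, smul_smul]
        · simp
      · split_ifs
        · rw [mul_smul_comm, hD]
        · simp
    · simp [chebCoeff_zero_zero]
    · intro a
      rcases lt_trichotomy a (m + 1) with h | h | h
      · obtain ⟨n, rfl⟩ : ∃ n, m = a + n := ⟨m - a, by omega⟩
        rw [if_pos (by omega), if_pos (by omega), if_pos (by omega),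
          show a + n + 2 - (a + 1) - 0 = n + 1 by omega,
          show a + n + 1 - (a + 1) - 0 = n by omega,
          show a + n + 1 - a - 0 = n + 1 by omega, ← sub_smul, chebCoeff_succ_zero_succ hq hv]
      · subst h
        rw [if_pos (by omega), if_neg (by omega), if_pos (by omega),
          show m + 2 - (m + 1 + 1) - 0 = 0 by omega,
          show m + 1 - (m + 1) - 0 = 0 by omega, chebCoeff_succ_zero_zero hq hv]
        simp
      · rw [if_neg (by omega), if_neg (by omega), if_neg (by omega), sub_zero]
    · intro b
      rcases lt_trichotomy b (m + 1) with h | h | h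
      · obtain ⟨n, rfl⟩ : ∃ n, m = b + n := ⟨m - b, by omega⟩
        rw [if_pos (by omega), if_pos (by omega), if_pos (by omega),
          show b + n + 2 - 0 - (b + 1) = n + 1 by omega,
          show b + n + 1 - 0 - (b + 1) = n by omega,
          show b + n + 1 - 0 - b = n + 1 by omega, ← sub_smul, chebCoeff_zero_succ_succ hq hv']
      · subst h
        rw [if_pos (by omega), if_neg (by omega), if_pos (by omega),
          show m + 2 - 0 - (m + 1 + 1) = 0 by omega,
          show m + 1 - 0 - (m + 1) = 0 by omega, chebCoeff_zero_succ_zero hq hv']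
        simp
      · rw [if_neg (by omega), if_neg (by omega), if_neg (by omega), sub_zero]
    · intro a b
      rcases lt_trichotomy (a + b) m with h | h | h
      · obtain ⟨n, rfl⟩ : ∃ n, m = a + b + n + 1 := ⟨m - a - b - 1, by omega⟩
        rw [if_pos (by omega), if_pos (by omega), if_pos (by omega), if_pos (by omega),
          if_pos (by omega),
          show a + b + n + 1 + 2 - (a + 1) - (b + 1) = n + 1 by omega,
          show a + b + n + 1 + 1 - (a + 1) - (b + 1) = n by omega,
          show a + b + n + 1 + 1 - (a + 1) - b = n + 1 by omega,
          show a + b + n + 1 + 1 - a - (b + 1) = n + 1 by omega,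
          show a + b + n + 1 - a - b = n + 1 by omega, ← sub_smul, ← sub_smul, ← sub_smul,
          chebCoeff_succ_succ_succ hq hv hv']
      · subst h
        rw [if_pos (by omega), if_neg (by omega), if_pos (by omega), if_pos (by omega),
          if_pos (by omega),
          show a + b + 2 - (a + 1) - (b + 1) = 0 by omega,
          show a + b + 1 - (a + 1) - b = 0 by omega,
          show a + b + 1 - a - (b + 1) = 0 by omega,
          show a + b - a - b = 0 by omega, chebCoeff_succ_succ_zero hq hv hv']
        simp [sub_smul]
      · rw [if_neg (by omega), if_neg (by omega), if_neg (by omega), if_neg (by omega),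
          if_neg (by omega)]
        simp
    · intro b
      exact if_neg (by omega)
    · intro a
      exact if_neg (by omega)
    · intro b
      exact if_neg (by omega)
    · intro a
      exact if_neg (by omega)

/-- No positive power of the variable of `ℚ(q)` equals `1`. -/
lemma ratFunc_X_pow_sub_one_ne_zero (n : ℕ) : (RatFunc.X : RatFunc ℚ) ^ (n + 1) - 1 ≠ 0 := by
  rw [← RatFunc.algebraMap_X, ← map_pow, ← map_one (algebraMap (Polynomial ℚ) (RatFunc ℚ)),
    ← map_sub]
  exact RatFunc.algebraMap_ne_zero (Polynomial.X_pow_sub_C_ne_zero n.succ_pos 1)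

/-- Multiplication of an ordered monomial by the Casimir element `FE - qK₊ - q⁻¹K₋`. -/
lemma casimir_mul_monomial {A : Type*} [Ring A] [Algebra (RatFunc ℚ) A]
    {q : RatFunc ℚ} (hq : q ≠ 0) {E F Kp Km : A}
    (hK : Kp * Km = Km * Kp)
    (hKpE : Kp * E = (q ^ 2) • (E * Kp))
    (hKmE : Km * E = (q⁻¹ ^ 2) • (E * Km))
    (hKpF : Kp * F = (q⁻¹ ^ 2) • (F * Kp))
    (hKmF : Km * F = (q ^ 2) • (F * Km))
    (hFKp : F * Kp = (q ^ 2) • (Kp * F))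
    (hFKm : F * Km = (q⁻¹ ^ 2) • (Km * F))
    (hEF : E * F - F * E = (q⁻¹ - q) • (Kp - Km)) (a b n : ℕ) :
    (F * E - q • Kp - q⁻¹ • Km) * (Kp ^ a * Km ^ b * F ^ n * E ^ n) =
      Kp ^ a * Km ^ b * F ^ (n + 1) * E ^ (n + 1) -
        q ^ (2 * n + 1) • (Kp ^ (a + 1) * Km ^ b * F ^ n * E ^ n) -
        q⁻¹ ^ (2 * n + 1) • (Kp ^ a * Km ^ (b + 1) * F ^ n * E ^ n) := by
  have cKp : Commute (F * E - q • Kp - q⁻¹ • Km) Kp := by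
    have h : Commute (F * E) Kp := by
      rw [Commute, SemiconjBy, ← mul_assoc Kp, hKpF, smul_mul_assoc, mul_assoc F Kp, hKpE,
        mul_smul_comm, smul_smul, mul_assoc]
      rw [← mul_pow, inv_mul_cancel₀ hq, one_pow, one_smul]
    have hK' : Commute Km Kp := hK.symm
    exact (h.sub_left ((Commute.refl Kp).smul_left q)).sub_left (hK'.smul_left q⁻¹)
  have cKm : Commute (F * E - q • Kp - q⁻¹ • Km) Km := by
    have h : Commute (F * E) Km := by
      rw [Commute, SemiconjBy, ← mul_assoc Km, hKmF, smul_mul_assoc, mul_assoc F Km, hKmE,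
        mul_smul_comm, smul_smul, mul_assoc]
      rw [← mul_pow, mul_inv_cancel₀ hq, one_pow, one_smul]
    have hK' : Commute Kp Km := hK
    exact (h.sub_left (hK'.smul_left q)).sub_left ((Commute.refl Km).smul_left q⁻¹)
  have cF : Commute (F * E - q • Kp - q⁻¹ • Km) F := by
    have hEF' : E * F = F * E + (q⁻¹ - q) • (Kp - Km) := by rw [← hEF]; abel
    have hq₁ : q * q⁻¹ ^ 2 = q⁻¹ := by field_simp
    have hq₂ : q⁻¹ * q ^ 2 = q := by field_simp
    rw [Commute, SemiconjBy]
    simp only [sub_mul, mul_sub, smul_mul_assoc, mul_smul_comm, mul_assoc F E F, hEF', mul_add,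
      hKpF, hKmF, smul_sub, sub_smul, smul_smul, hq₁, hq₂]
    abel
  have hFp := pow_mul_pow_of_skew hFKp n 1
  have hFm := pow_mul_pow_of_skew hFKm n 1
  have hKpm : Km ^ b * Kp = Kp * Km ^ b := ((show Commute Kp Km from hK).pow_right b).eq.symm
  rw [pow_one, mul_one, ← pow_mul] at hFp hFm
  have hcomm := ((cKp.pow_right a).mul_right (cKm.pow_right b)).mul_right (cF.pow_right n)
  have e₁ : Kp ^ a * Km ^ b * F ^ n * (F * E) * E ^ n =
      Kp ^ a * Km ^ b * F ^ (n + 1) * E ^ (n + 1) := by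
    rw [pow_succ F, pow_succ' E]
    simp only [mul_assoc]
  have e₂ : Kp ^ a * Km ^ b * F ^ n * Kp * E ^ n =
      q ^ (2 * n) • (Kp ^ (a + 1) * Km ^ b * F ^ n * E ^ n) := by
    rw [mul_assoc _ (F ^ n) Kp, hFp, mul_smul_comm, smul_mul_assoc, ← mul_assoc _ Kp (F ^ n),
      mul_assoc (Kp ^ a) (Km ^ b) Kp, hKpm, ← mul_assoc (Kp ^ a) Kp, ← pow_succ]
  have e₃ : Kp ^ a * Km ^ b * F ^ n * Km * E ^ n =
      q⁻¹ ^ (2 * n) • (Kp ^ a * Km ^ (b + 1) * F ^ n * E ^ n) := by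
    rw [mul_assoc _ (F ^ n) Km, hFm, mul_smul_comm, smul_mul_assoc, ← mul_assoc _ Km (F ^ n),
      mul_assoc (Kp ^ a) (Km ^ b) Km, ← pow_succ]
  rw [← mul_assoc, hcomm.eq, mul_sub, mul_sub, sub_mul, sub_mul, e₁, mul_smul_comm,
    mul_smul_comm, smul_mul_assoc, smul_mul_assoc, e₂, e₃, smul_smul, smul_smul, ← pow_succ',
    ← pow_succ']

/-- explicit expansions of `F^k C⁽ᵐ⁾` and `C⁽ᵐ⁾ E^k` in `U_q(s̃l₂)`. -/
theorem statement6 {A : Type*} [Ring A] [Algebra (RatFunc ℚ) A]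
    (q : RatFunc ℚ) (hq : q = RatFunc.X)
    (E F Kp Km : A)
    (hK : Kp * Km = Km * Kp)
    (hKpE : Kp * E = (q ^ 2) • (E * Kp))
    (hKmE : Km * E = (q⁻¹ ^ 2) • (E * Km))
    (hKpF : Kp * F = (q⁻¹ ^ 2) • (F * Kp))
    (hKmF : Km * F = (q ^ 2) • (F * Km))
    (hEF : E * F - F * E = (q⁻¹ - q) • (Kp - Km))
    (C : A) (hC : C = F * E - q • Kp - q⁻¹ • Km) (m k : ℕ) :
    F ^ k * cheb C (Kp * Km) m =
      ∑ a ∈ Finset.range (m + 1), ∑ b ∈ Finset.range (m + 1 - a),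
        (((-1 : RatFunc ℚ) ^ (a + b) * q ^ ((2 * (k : ℤ) + 1) * ((a : ℤ) - (b : ℤ))) *
            gbinom ((q ^ 2)⁻¹) (m - a) b * gbinom (q ^ 2) (m - b) a) •
          (Kp ^ a * Km ^ b * F ^ (m + k - a - b) * E ^ (m - a - b))) ∧
    cheb C (Kp * Km) m * E ^ k =
      ∑ a ∈ Finset.range (m + 1), ∑ b ∈ Finset.range (m + 1 - a),
        (((-1 : RatFunc ℚ) ^ (a + b) * q ^ ((a : ℤ) - (b : ℤ)) *
            gbinom ((q ^ 2)⁻¹) (m - a) b * gbinom (q ^ 2) (m - b) a) •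
          (Kp ^ a * Km ^ b * F ^ (m - a - b) * E ^ (m + k - a - b))) := by
  have hq0 : q ≠ 0 := hq ▸ RatFunc.X_ne_zero
  have hv : ∀ t : ℕ, (q ^ 2) ^ (t + 1) - 1 ≠ 0 := by
    intro t
    rw [← pow_mul, hq]
    exact ratFunc_X_pow_sub_one_ne_zero (2 * t + 1)
  have hv' : ∀ t : ℕ, ((q ^ 2)⁻¹) ^ (t + 1) - 1 ≠ 0 := by
    intro t h
    rw [inv_pow, sub_eq_zero, inv_eq_one] at h
    exact hv t (sub_eq_zero.mpr h)
  have hFKp : F * Kp = (q ^ 2) • (Kp * F) := by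
    rw [hKpF, smul_smul, ← mul_pow, mul_inv_cancel₀ hq0, one_pow, one_smul]
  have hFKm : F * Km = (q⁻¹ ^ 2) • (Km * F) := by
    rw [hKmF, smul_smul, ← mul_pow, inv_mul_cancel₀ hq0, one_pow, one_smul]
  have hcheb := cheb_eq_sum hq0 hv hv' C (Kp * Km)
    (fun a b n => Kp ^ a * Km ^ b * F ^ n * E ^ n) (by simp)
    (fun a b n => hC ▸ casimir_mul_monomial hq0 hK hKpE hKmE hKpF hKmF hFKp hFKm hEF a b n)
    (fun a b n => by
      have h : Kp * Km * Kp ^ a = Kp ^ (a + 1) * Km := by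
        rw [mul_assoc, ((show Commute Km Kp from hK.symm).pow_right a).eq, ← mul_assoc,
          ← pow_succ']
      simp only [← mul_assoc]
      rw [h, mul_assoc _ Km, ← pow_succ']) m (m + 1) m.lt_succ_self
  rw [← sum_triangle (fun a b => chebCoeff q a b (m - a - b) •
    (Kp ^ a * Km ^ b * F ^ (m - a - b) * E ^ (m - a - b))) m (m + 1) m.lt_succ_self] at hcheb
  rw [hcheb]
  simp only [Finset.mul_sum, Finset.sum_mul]
  constructor <;>
    refine Finset.sum_congr rfl fun a ha => Finset.sum_congr rfl fun b hb => ?_ <;>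
    obtain ⟨n, rfl⟩ : ∃ n, m = a + b + n := ⟨m - a - b, by
      simp only [Finset.mem_range] at ha hb; omega⟩ <;>
    rw [show a + b + n - a - b = n by omega, show a + b + n + k - a - b = n + k by omega,
      show a + b + n - a = n + b by omega, show a + b + n - b = n + a by omega, chebCoeff]
  · have hFk : F ^ k * (Kp ^ a * Km ^ b * F ^ n * E ^ n) =
        ((q ^ 2) ^ (k * a) * (q⁻¹ ^ 2) ^ (k * b)) •
          (Kp ^ a * Km ^ b * F ^ (n + k) * E ^ n) := by
      simp only [← mul_assoc]
      rw [pow_mul_pow_of_skew hFKp k a, smul_mul_assoc, mul_assoc (Kp ^ a),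
        pow_mul_pow_of_skew hFKm k b, mul_smul_comm, smul_smul, smul_mul_assoc, smul_mul_assoc,
        ← mul_assoc, mul_assoc _ (F ^ k) (F ^ n), ← pow_add, Nat.add_comm k n]
    rw [mul_smul_comm, hFk, smul_smul]
    congr 1
    have hz : q ^ ((2 * (k : ℤ) + 1) * ((a : ℤ) - (b : ℤ))) =
        q ^ ((a : ℤ) - (b : ℤ)) * ((q ^ 2) ^ (k * a) * (q⁻¹ ^ 2) ^ (k * b)) := by
      rw [inv_pow, inv_pow, ← pow_mul, ← pow_mul, ← zpow_natCast, ← zpow_natCast, ← zpow_neg,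
        ← zpow_add₀ hq0, ← zpow_add₀ hq0]
      congr 1
      push_cast
      ring
    rw [hz]
    ring
  · rw [smul_mul_assoc, mul_assoc _ (E ^ n) (E ^ k), ← pow_add]
end
end
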